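/- Let n ≥ 1, and let M₁ and M₂ be topological spaces with closed subsets B₁ ⊆ M₁ and B₂ ⊆ M₂. Assume: (i) for i = 1, 2 there is a homeomorphism cᵢ from Bᵢ × [0,1) onto an open subset Uᵢ of Mᵢ with cᵢ(x, 0) = x for all x ∈ Bᵢ and cᵢ(Bᵢ × (0,1)) ⊆ Mᵢ \ Bᵢ (a collar of Bᵢ); (ii) every point of Mᵢ \ Bᵢ has an open neighborhood homeomorphic to an open subset of EuclideanSpace ℝ (Fin n); (iii) every point of Bᵢ has an open neighborhood in Bᵢ homeomorphic to an open subset of EuclideanSpace ℝ (Fin (n−1)); and (iv) there is a homeomorphism h : B₁ ≃ B₂. Let Q be the quotient of the disjoint union M₁ ⊕ M₂ by the equivalence relation generated by identifying x ∈ B₁ with h(x) ∈ B₂. Then every point of Q has an open neighborhood homeomorphic to an open subset of EuclideanSpace ℝ (Fin n). (Gluing two collared, locally Euclidean spaces along a homeomorphism of their collared boundaries yields a locally Euclidean space of the same dimension; this is the topological content of the gluing lemma for manifolds with faces.) -/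

import Mathlib

noncomputable section

open Set

/-- The relation on `M₁ ⊕ M₂` identifying each `x ∈ B₁` with `h x ∈ B₂`. -/
def glueRel {M₁ M₂ : Type*} [TopologicalSpace M₁] [TopologicalSpace M₂]
    (B₁ : Set M₁) (B₂ : Set M₂) (h : ↥B₁ ≃ₜ ↥B₂) : M₁ ⊕ M₂ → M₁ ⊕ M₂ → Prop :=
  fun a b => ∃ x : ↥B₁, a = Sum.inl (x : M₁) ∧ b = Sum.inr ((h x : M₂))

/-- The point `x` has an open neighborhood homeomorphic to an open subset of `ℝⁿ`. -/
def IsLocallyEuclideanAt (n : ℕ) {X : Type*} [TopologicalSpace X] (x : X) : Prop :=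
  ∃ (U : Set X) (V : Set (EuclideanSpace ℝ (Fin n))),
    IsOpen U ∧ IsOpen V ∧ x ∈ U ∧ Nonempty (↥U ≃ₜ ↥V)

namespace IsLocallyEuclideanAt

variable {X Y : Type*} [TopologicalSpace X] [TopologicalSpace Y]

theorem map {n : ℕ} {x : X} (hx : IsLocallyEuclideanAt n x) {f : X → Y}
    (hf : Topology.IsOpenEmbedding f) : IsLocallyEuclideanAt n (f x) := by
  obtain ⟨U, V, hU, hV, hxU, ⟨e⟩⟩ := hx
  exact ⟨f '' U, V, hf.isOpenMap U hU, hV, mem_image_of_mem f hxU,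
    ⟨(hf.isEmbedding.homeomorphImage U).symm.trans e⟩⟩

theorem subtype {n : ℕ} {x : X} (hx : IsLocallyEuclideanAt n x) {s : Set X} (hs : IsOpen s)
    (hxs : x ∈ s) : IsLocallyEuclideanAt n (⟨x, hxs⟩ : s) := by
  obtain ⟨U, V, hU, hV, hxU, ⟨e⟩⟩ := hx
  let W : Set U := Subtype.val ⁻¹' s
  have hg : Topology.IsOpenEmbedding (fun w : W => (⟨w.1.1, w.2⟩ : s)) := by
    refine Topology.IsOpenEmbedding.of_comp _ hs.isOpenEmbedding_subtypeVal ?_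
    exact hU.isOpenEmbedding_subtypeVal.comp
      (hs.preimage continuous_subtype_val).isOpenEmbedding_subtypeVal
  have hf : Topology.IsOpenEmbedding (fun w : W => (e w.1 : EuclideanSpace ℝ (Fin n))) :=
    hV.isOpenEmbedding_subtypeVal.comp <| e.isOpenEmbedding.comp
      (hs.preimage continuous_subtype_val).isOpenEmbedding_subtypeVal
  exact ⟨range fun w : W => (⟨w.1.1, w.2⟩ : s), _, hg.isOpen_range, hf.isOpen_range,
    ⟨⟨⟨x, hxU⟩, hxs⟩, rfl⟩,
    ⟨hg.isEmbedding.toHomeomorph.symm.trans hf.isEmbedding.toHomeomorph⟩⟩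

theorem prodMk {n : ℕ} {x : X} (hx : IsLocallyEuclideanAt n x) {s : Set ℝ} (hs : IsOpen s)
    (t : s) : IsLocallyEuclideanAt (n + 1) (x, t) := by
  obtain ⟨U, V, hU, hV, hxU, ⟨e⟩⟩ := hx
  let L : (EuclideanSpace ℝ (Fin n) × ℝ) ≃L[ℝ] EuclideanSpace ℝ (Fin (n + 1)) :=
    ContinuousLinearEquiv.ofFinrankEq (by simp)
  have hg : Topology.IsOpenEmbedding (Prod.map Subtype.val id : U × s → X × s) :=
    hU.isOpenEmbedding_subtypeVal.prodMap .id
  have hf : Topology.IsOpenEmbedding (L ∘ Prod.map (Subtype.val ∘ e) Subtype.val : U × s → _) :=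
    L.toHomeomorph.isOpenEmbedding.comp <|
      (hV.isOpenEmbedding_subtypeVal.comp e.isOpenEmbedding).prodMap hs.isOpenEmbedding_subtypeVal
  exact ⟨_, _, hg.isOpen_range, hf.isOpen_range, ⟨(⟨x, hxU⟩, t), rfl⟩,
    ⟨hg.isEmbedding.toHomeomorph.symm.trans hf.isEmbedding.toHomeomorph⟩⟩

end IsLocallyEuclideanAt

section Glue

variable {M₁ M₂ : Type*} [TopologicalSpace M₁] [TopologicalSpace M₂]
  {B₁ : Set M₁} {B₂ : Set M₂} {h : ↥B₁ ≃ₜ ↥B₂}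

open Classical in
/-- The section of the quotient map that represents the points of the seam in `M₂`. -/
def glueRepr (z : Quot (glueRel B₁ B₂ h)) : M₁ ⊕ M₂ :=
  Quot.lift (Sum.elim (fun x => if hx : x ∈ B₁ then Sum.inr ↑(h ⟨x, hx⟩) else Sum.inl x) Sum.inr)
    (by rintro _ _ ⟨x, rfl, rfl⟩; simp) z

theorem glue_inl_eq_inl_iff {x y : M₁} :
    Quot.mk (glueRel B₁ B₂ h) (.inl x) = Quot.mk _ (.inl y) ↔ x = y := by
  refine ⟨fun e => ?_, fun e => e ▸ rfl⟩
  have e' := congrArg glueRepr e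
  by_cases hx : x ∈ B₁ <;> by_cases hy : y ∈ B₁ <;>
    simp [glueRepr, hx, hy, Subtype.val_inj] at e' <;> exact e'

theorem glue_inr_eq_inr_iff {x y : M₂} :
    Quot.mk (glueRel B₁ B₂ h) (.inr x) = Quot.mk _ (.inr y) ↔ x = y :=
  ⟨fun e => Sum.inr_injective (congrArg glueRepr e), fun e => e ▸ rfl⟩

theorem mem_of_glue_inl_eq_inr {x : M₁} {y : M₂}
    (e : Quot.mk (glueRel B₁ B₂ h) (.inl x) = Quot.mk _ (.inr y)) : x ∈ B₁ ∧ y ∈ B₂ := by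
  have e' := congrArg glueRepr e
  by_cases hx : x ∈ B₁
  · simp only [glueRepr, Sum.elim_inl, hx, ↓reduceDIte, Sum.elim_inr, Sum.inr.injEq] at e'
    exact ⟨hx, e' ▸ (h ⟨x, hx⟩).2⟩
  · simp [glueRepr, hx] at e'

theorem glue_coe_eq (b : B₁) :
    Quot.mk (glueRel B₁ B₂ h) (.inl b) = Quot.mk _ (.inr (h b)) :=
  Quot.sound ⟨b, rfl, rfl⟩

theorem isOpen_glue_iff {s : Set (Quot (glueRel B₁ B₂ h))} :
    IsOpen s ↔ IsOpen ((fun x => Quot.mk _ (.inl x)) ⁻¹' s) ∧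
      IsOpen ((fun y => Quot.mk _ (.inr y)) ⁻¹' s) := by
  rw [← isQuotientMap_quot_mk.isOpen_preimage, isOpen_sum_iff]
  rfl

theorem isOpenEmbedding_glue_inl (hB₁ : IsClosed B₁) :
    Topology.IsOpenEmbedding
      (fun x : ↥B₁ᶜ => Quot.mk (glueRel B₁ B₂ h) (.inl x.1)) := by
  refine .of_continuous_injective_isOpenMap
    (continuous_quot_mk.comp (continuous_inl.comp continuous_subtype_val))
    (fun x y e => Subtype.ext (glue_inl_eq_inl_iff.1 e)) fun s hs => isOpen_glue_iff.2 ⟨?_, ?_⟩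
  · convert hB₁.isOpen_compl.isOpenMap_subtype_val s hs using 1
    ext x
    simp [glue_inl_eq_inl_iff]
  · convert isOpen_empty
    refine eq_empty_of_forall_notMem ?_
    rintro y ⟨x, -, e⟩
    exact x.2 (mem_of_glue_inl_eq_inr e).1

theorem isOpenEmbedding_glue_inr (hB₂ : IsClosed B₂) :
    Topology.IsOpenEmbedding
      (fun x : ↥B₂ᶜ => Quot.mk (glueRel B₁ B₂ h) (.inr x.1)) := by
  refine .of_continuous_injective_isOpenMap
    (continuous_quot_mk.comp (continuous_inr.comp continuous_subtype_val))
    (fun x y e => Subtype.ext (glue_inr_eq_inr_iff.1 e)) fun s hs => isOpen_glue_iff.2 ⟨?_, ?_⟩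
  · convert isOpen_empty
    refine eq_empty_of_forall_notMem ?_
    rintro y ⟨x, -, e⟩
    exact x.2 (mem_of_glue_inl_eq_inr e.symm).2
  · convert hB₂.isOpen_compl.isOpenMap_subtype_val s hs using 1
    ext x
    simp [glue_inr_eq_inr_iff]

/-- Two collars parametrized by the same space `A` and agreeing along the seam combine to an open
embedding of the bicollar `A × (-1, 1)`. -/
theorem exists_isOpenEmbedding_bicollar {A : Type*} [TopologicalSpace A]
    {κ₁ : A × Ico (0 : ℝ) 1 → M₁} {κ₂ : A × Ico (0 : ℝ) 1 → M₂}
    (hκ₁ : Topology.IsOpenEmbedding κ₁) (hκ₂ : Topology.IsOpenEmbedding κ₂)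
    (h₁ : ∀ p, κ₁ p ∈ B₁ → p.2.1 = 0) (h₂ : ∀ p, κ₂ p ∈ B₂ → p.2.1 = 0)
    (h₀ : ∀ p, p.2.1 = 0 →
      Quot.mk (glueRel B₁ B₂ h) (.inl (κ₁ p)) = Quot.mk _ (.inr (κ₂ p))) :
    ∃ ψ : A × Ioo (-1 : ℝ) 1 → Quot (glueRel B₁ B₂ h), Topology.IsOpenEmbedding ψ ∧
      ∀ a, ψ (a, ⟨0, by norm_num⟩) = Quot.mk _ (.inl (κ₁ (a, ⟨0, by norm_num⟩))) := by
  let r₁ : A × Ioo (-1 : ℝ) 1 → A × Ico (0 : ℝ) 1 := fun q =>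
    (q.1, ⟨max q.2.1 0, le_max_right _ _, max_lt q.2.2.2 one_pos⟩)
  let r₂ : A × Ioo (-1 : ℝ) 1 → A × Ico (0 : ℝ) 1 := fun q =>
    (q.1, ⟨max (-q.2.1) 0, le_max_right _ _, max_lt (by linarith [q.2.2.1]) one_pos⟩)
  let j₁ : A × Ico (0 : ℝ) 1 → A × Ioo (-1 : ℝ) 1 := fun p =>
    (p.1, ⟨p.2.1, by linarith [p.2.2.1], p.2.2.2⟩)
  let j₂ : A × Ico (0 : ℝ) 1 → A × Ioo (-1 : ℝ) 1 := fun p =>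
    (p.1, ⟨-p.2.1, by linarith [p.2.2.2], by linarith [p.2.2.1]⟩)
  have hr₁ : Continuous r₁ := by fun_prop
  have hr₂ : Continuous r₂ := by fun_prop
  have hj₁ : Continuous j₁ := by fun_prop
  have hj₂ : Continuous j₂ := by fun_prop
  have hj (p) (hp : p.2.1 = 0) : j₁ p = j₂ p := by simp [j₁, j₂, hp]
  have hcover (q) : (∃ p, q = j₁ p) ∨ ∃ p, q = j₂ p := by
    obtain ⟨a, t, ht⟩ := q
    rcases le_total 0 t with h0 | h0
    · exact .inl ⟨(a, ⟨t, h0, ht.2⟩), rfl⟩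
    · exact .inr ⟨(a, ⟨-t, by linarith, by linarith [ht.1]⟩), by simp [j₂]⟩
  have hrj₁ (p) : r₁ (j₁ p) = p := by
    ext <;> simp [r₁, j₁, p.2.2.1]
  have hrj₂ (p) : r₂ (j₂ p) = p := by
    ext <;> simp [r₂, j₂, p.2.2.1]
  let ψ : A × Ioo (-1 : ℝ) 1 → Quot (glueRel B₁ B₂ h) := fun q =>
    if 0 ≤ q.2.1 then Quot.mk _ (.inl (κ₁ (r₁ q))) else Quot.mk _ (.inr (κ₂ (r₂ q)))
  have hψc : Continuous ψ := by
    refine Continuous.if_le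
      (continuous_quot_mk.comp (continuous_inl.comp (hκ₁.continuous.comp hr₁)))
      (continuous_quot_mk.comp (continuous_inr.comp (hκ₂.continuous.comp hr₂)))
      continuous_const (by fun_prop) fun q hq => ?_
    have e : r₂ q = r₁ q := by simp [r₁, r₂, ← hq]
    exact e ▸ h₀ (r₁ q) (by simp [r₁, ← hq])
  have hψ₁ (p) : ψ (j₁ p) = Quot.mk _ (.inl (κ₁ p)) := by
    simp only [ψ, hrj₁]
    exact if_pos p.2.2.1
  have hψ₂ (p) : ψ (j₂ p) = Quot.mk _ (.inr (κ₂ p)) := by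
    by_cases hp : p.2.1 = 0
    · rw [← hj p hp, hψ₁, h₀ p hp]
    · simp only [ψ, hrj₂]
      have := lt_of_le_of_ne p.2.2.1 (Ne.symm hp)
      exact if_neg (by simpa [j₂] using this)
  have hcross {p p'} (e : ψ (j₁ p) = ψ (j₂ p')) : p = p' ∧ p.2.1 = 0 := by
    have e' := e
    rw [hψ₁, hψ₂] at e'
    have hm := mem_of_glue_inl_eq_inr e'
    rw [← hj p' (h₂ _ hm.2), hψ₁, hψ₁, glue_inl_eq_inl_iff] at e
    exact ⟨hκ₁.injective e, h₁ _ hm.1⟩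
  refine ⟨ψ, .of_continuous_injective_isOpenMap hψc ?_ ?_,
    fun a => hψ₁ (a, ⟨0, by norm_num⟩)⟩
  · intro q q' e
    rcases hcover q with ⟨p, rfl⟩ | ⟨p, rfl⟩ <;> rcases hcover q' with ⟨p', rfl⟩ | ⟨p', rfl⟩
    · rw [hψ₁, hψ₁, glue_inl_eq_inl_iff] at e
      rw [hκ₁.injective e]
    · obtain ⟨rfl, hp⟩ := hcross e
      exact hj p hp
    · obtain ⟨rfl, hp⟩ := hcross e.symm
      exact (hj _ hp).symm
    · rw [hψ₂, hψ₂, glue_inr_eq_inr_iff] at e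
      rw [hκ₂.injective e]
  · intro O hO
    refine isOpen_glue_iff.2 ⟨?_, ?_⟩
    · convert hκ₁.isOpenMap _ (hO.preimage hj₁) using 1
      ext m
      constructor
      · rintro ⟨q, hq, e⟩
        rcases hcover q with ⟨p, rfl⟩ | ⟨p, rfl⟩
        · rw [hψ₁, glue_inl_eq_inl_iff] at e
          exact ⟨p, hq, e⟩
        · have hp : p.2.1 = 0 := h₂ _ (mem_of_glue_inl_eq_inr (e.symm.trans (hψ₂ p))).2
          rw [← hj p hp] at hq e
          rw [hψ₁, glue_inl_eq_inl_iff] at e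
          exact ⟨p, hq, e⟩
      · rintro ⟨p, hp, rfl⟩
        exact ⟨j₁ p, hp, hψ₁ p⟩
    · convert hκ₂.isOpenMap _ (hO.preimage hj₂) using 1
      ext m
      constructor
      · rintro ⟨q, hq, e⟩
        rcases hcover q with ⟨p, rfl⟩ | ⟨p, rfl⟩
        · have hp : p.2.1 = 0 := h₁ _ (mem_of_glue_inl_eq_inr ((hψ₁ p).symm.trans e)).1
          rw [hj p hp] at hq e
          rw [hψ₂, glue_inr_eq_inr_iff] at e
          exact ⟨p, hq, e⟩
        · rw [hψ₂, glue_inr_eq_inr_iff] at e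
          exact ⟨p, hq, e⟩
      · rintro ⟨p, hp, rfl⟩
        exact ⟨j₂ p, hp, hψ₂ p⟩

end Glue

/-- Gluing two collared, locally Euclidean spaces of dimension `n` (whose boundaries are
locally Euclidean of dimension `n − 1`) along a homeomorphism of their boundaries yields a
locally Euclidean space of dimension `n`. -/
theorem glued_collared_spaces_locally_euclidean
    (n : ℕ) (hn : 1 ≤ n)
    (M₁ M₂ : Type*) [TopologicalSpace M₁] [TopologicalSpace M₂]
    (B₁ : Set M₁) (B₂ : Set M₂) (hB₁ : IsClosed B₁) (hB₂ : IsClosed B₂)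
    -- (i) collars of the boundaries
    (U₁ : Set M₁) (hU₁ : IsOpen U₁)
    (c₁ : (↥B₁ × ↥(Set.Ico (0 : ℝ) 1)) ≃ₜ ↥U₁)
    (hc₁0 : ∀ x : ↥B₁,
      ((c₁ (x, ⟨0, Set.left_mem_Ico.mpr zero_lt_one⟩) : M₁)) = (x : M₁))
    (hc₁pos : ∀ (x : ↥B₁) (t : ↥(Set.Ico (0 : ℝ) 1)), 0 < (t : ℝ) →
      ((c₁ (x, t) : M₁)) ∉ B₁)
    (U₂ : Set M₂) (hU₂ : IsOpen U₂)
    (c₂ : (↥B₂ × ↥(Set.Ico (0 : ℝ) 1)) ≃ₜ ↥U₂)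
    (hc₂0 : ∀ x : ↥B₂,
      ((c₂ (x, ⟨0, Set.left_mem_Ico.mpr zero_lt_one⟩) : M₂)) = (x : M₂))
    (hc₂pos : ∀ (x : ↥B₂) (t : ↥(Set.Ico (0 : ℝ) 1)), 0 < (t : ℝ) →
      ((c₂ (x, t) : M₂)) ∉ B₂)
    -- (ii) the interiors are locally Euclidean of dimension n
    (hint₁ : ∀ x : M₁, x ∉ B₁ → ∃ (U : Set M₁) (V : Set (EuclideanSpace ℝ (Fin n))),
      IsOpen U ∧ IsOpen V ∧ x ∈ U ∧ Nonempty (↥U ≃ₜ ↥V))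
    (hint₂ : ∀ x : M₂, x ∉ B₂ → ∃ (U : Set M₂) (V : Set (EuclideanSpace ℝ (Fin n))),
      IsOpen U ∧ IsOpen V ∧ x ∈ U ∧ Nonempty (↥U ≃ₜ ↥V))
    -- (iii) the boundaries are locally Euclidean of dimension n − 1
    (hbd₁ : ∀ x : ↥B₁, ∃ (U : Set ↥B₁) (V : Set (EuclideanSpace ℝ (Fin (n - 1)))),
      IsOpen U ∧ IsOpen V ∧ x ∈ U ∧ Nonempty (↥U ≃ₜ ↥V))
    (hbd₂ : ∀ x : ↥B₂, ∃ (U : Set ↥B₂) (V : Set (EuclideanSpace ℝ (Fin (n - 1)))),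
      IsOpen U ∧ IsOpen V ∧ x ∈ U ∧ Nonempty (↥U ≃ₜ ↥V))
    -- (iv) a homeomorphism of the boundaries
    (h : ↥B₁ ≃ₜ ↥B₂) :
    -- conclusion: the glued space is locally Euclidean of dimension n
    ∀ z : Quot (glueRel B₁ B₂ h),
      ∃ (U : Set (Quot (glueRel B₁ B₂ h))) (V : Set (EuclideanSpace ℝ (Fin n))),
        IsOpen U ∧ IsOpen V ∧ z ∈ U ∧ Nonempty (↥U ≃ₜ ↥V) := by
  obtain ⟨m, rfl⟩ : ∃ m, n = m + 1 := ⟨n - 1, by omega⟩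
  have hzero {t : Ico (0 : ℝ) 1} (ht : t.1 = 0) :
      t = ⟨0, Set.left_mem_Ico.mpr zero_lt_one⟩ := Subtype.ext ht
  have hseam (b : B₁) :
      IsLocallyEuclideanAt (m + 1) (Quot.mk (glueRel B₁ B₂ h) (.inl b.1)) := by
    obtain ⟨ψ, hψ, hψ₀⟩ := exists_isOpenEmbedding_bicollar (h := h)
      (κ₁ := fun p => (c₁ p : M₁)) (κ₂ := fun p => (c₂ (h p.1, p.2) : M₂))
      (hU₁.isOpenEmbedding_subtypeVal.comp c₁.isOpenEmbedding)
      (hU₂.isOpenEmbedding_subtypeVal.comp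
        (c₂.isOpenEmbedding.comp (h.isOpenEmbedding.prodMap .id)))
      (fun p hp => by
        by_contra h0
        exact hc₁pos p.1 p.2 (lt_of_le_of_ne p.2.2.1 (Ne.symm h0)) hp)
      (fun p hp => by
        by_contra h0
        exact hc₂pos (h p.1) p.2 (lt_of_le_of_ne p.2.2.1 (Ne.symm h0)) hp)
      (fun ⟨a, t⟩ ht => by
        obtain rfl := hzero ht
        simp only [hc₁0, hc₂0, glue_coe_eq])
    have hb : IsLocallyEuclideanAt m b := hbd₁ b
    have := (hb.prodMk isOpen_Ioo ⟨(0 : ℝ), by norm_num⟩).map hψ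
    rwa [hψ₀, hc₁0] at this
  intro z
  change IsLocallyEuclideanAt (m + 1) z
  obtain ⟨x | y, rfl⟩ := Quot.exists_rep z
  · by_cases hx : x ∈ B₁
    · exact hseam ⟨x, hx⟩
    · exact (IsLocallyEuclideanAt.subtype (hint₁ x hx) hB₁.isOpen_compl hx).map
        (isOpenEmbedding_glue_inl hB₁)
  · by_cases hy : y ∈ B₂
    · have := hseam (h.symm ⟨y, hy⟩)
      rwa [glue_coe_eq, h.apply_symm_apply] at this
    · exact (IsLocallyEuclideanAt.subtype (hint₂ y hy) hB₂.isOpen_compl hy).map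
        (isOpenEmbedding_glue_inr hB₂)
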